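/- For an odd prime K, the quadratic Gauss sum G = Σ_{α=0}^{K-1} q^(α²), where q = e^(2πi/K), satisfies G² = (-1)^((K-1)/2) · K. Consequently G = √K if K ≡ 1 mod 4 and G = i√K if K ≡ 3 mod 4. -/

import Mathlib

/-- The Gaussian binomial coefficient `[n, k]` evaluated at `x`. -/
def gaussBinom {R : Type*} [Semiring R] (x : R) : ℕ → ℕ → R
  | _, 0 => 1
  | 0, _ + 1 => 0
  | n + 1, k + 1 => gaussBinom x n k + x ^ (k + 1) * gaussBinom x n (k + 1)

namespace gaussBinom

section Semiring

variable {R : Type*} [Semiring R] (x : R)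

@[simp]
theorem zero_right (n : ℕ) : gaussBinom x n 0 = 1 := by
  cases n <;> rfl

@[simp]
theorem zero_succ (k : ℕ) : gaussBinom x 0 (k + 1) = 0 := rfl

theorem succ_succ (n k : ℕ) :
    gaussBinom x (n + 1) (k + 1) =
      gaussBinom x n k + x ^ (k + 1) * gaussBinom x n (k + 1) := rfl

theorem eq_zero_of_lt {n k : ℕ} (h : n < k) : gaussBinom x n k = 0 := by
  induction n generalizing k with
  | zero =>
    obtain ⟨k, rfl⟩ := Nat.exists_eq_succ_of_ne_zero (by omega : k ≠ 0)
    rfl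
  | succ n ih =>
    obtain ⟨k, rfl⟩ := Nat.exists_eq_succ_of_ne_zero (by omega : k ≠ 0)
    rw [Nat.succ_eq_add_one, succ_succ, ih (by omega), ih (by omega), mul_zero, add_zero]

end Semiring

section CommRing

variable {R : Type*} [CommRing R] (x : R)

theorem one_sub_pow_mul (n k : ℕ) :
    (1 - x ^ (k + 1)) * gaussBinom x (n + 1) (k + 1) =
      (1 - x ^ (n + 1)) * gaussBinom x n k := by
  induction n generalizing k with
  | zero => cases k <;> simp [succ_succ]
  | succ n ih =>
    rw [succ_succ x (n + 1) k]
    cases k with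
    | zero =>
      have h := ih 0
      simp only [zero_right] at h ⊢
      linear_combination x * h
    | succ k =>
      linear_combination x ^ (k + 2) * ih (k + 1) + x * ih k -
        x * (1 - x ^ (n + 1)) * succ_succ x n k

/-- Gauss's recurrence for the alternating sum of Gaussian binomial coefficients. -/
theorem alternating_sum_add_two (n : ℕ) :
    ∑ k ∈ Finset.range (n + 3), (-1) ^ k * gaussBinom x (n + 2) k =
      (1 - x ^ (n + 1)) * ∑ k ∈ Finset.range (n + 1), (-1) ^ k * gaussBinom x n k := by
  have h₁ := Finset.sum_range_succ' (fun k ↦ (-1) ^ k * gaussBinom x (n + 2) k) (n + 2)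
  have h₂ := Finset.sum_range_succ (fun k ↦ (-1) ^ k * gaussBinom x (n + 1) k) (n + 1)
  have h₃ := Finset.sum_range_succ' (fun k ↦ (-1) ^ k * gaussBinom x (n + 1) k) (n + 1)
  have h₄ := Finset.sum_range_succ
    (fun k ↦ (-1) ^ (k + 1) * (x ^ (k + 1) * gaussBinom x (n + 1) (k + 1))) (n + 1)
  have h₅ : ∑ k ∈ Finset.range (n + 2), (-1) ^ (k + 1) * gaussBinom x (n + 2) (k + 1) =
      -∑ k ∈ Finset.range (n + 2), (-1) ^ k * gaussBinom x (n + 1) k +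
        ∑ k ∈ Finset.range (n + 2),
          (-1) ^ (k + 1) * (x ^ (k + 1) * gaussBinom x (n + 1) (k + 1)) := by
    rw [← Finset.sum_neg_distrib, ← Finset.sum_add_distrib]
    refine Finset.sum_congr rfl fun k _ ↦ ?_
    rw [succ_succ x (n + 1) k]
    ring
  have h₆ : (1 - x ^ (n + 1)) * ∑ k ∈ Finset.range (n + 1), (-1) ^ k * gaussBinom x n k =
      -∑ k ∈ Finset.range (n + 1), (-1) ^ (k + 1) * gaussBinom x (n + 1) (k + 1) +
        ∑ k ∈ Finset.range (n + 1),
          (-1) ^ (k + 1) * (x ^ (k + 1) * gaussBinom x (n + 1) (k + 1)) := by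
    rw [← Finset.sum_neg_distrib, ← Finset.sum_add_distrib, Finset.mul_sum]
    refine Finset.sum_congr rfl fun k _ ↦ ?_
    linear_combination -(-1) ^ k * one_sub_pow_mul x n k
  simp only [eq_zero_of_lt x (Nat.lt_succ_self (n + 1)), zero_right, mul_zero, add_zero,
    pow_zero, mul_one] at h₁ h₃ h₄
  rw [h₁, h₅, h₃, h₄, h₆]
  ring

theorem alternating_sum_two_mul (m : ℕ) :
    ∑ k ∈ Finset.range (2 * m + 1), (-1) ^ k * gaussBinom x (2 * m) k =
      ∏ t ∈ Finset.range m, (1 - x ^ (2 * t + 1)) := by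
  induction m with
  | zero => simp
  | succ m ih =>
    rw [Finset.prod_range_succ, ← ih, mul_comm (∑ _ ∈ _, _)]
    exact alternating_sum_add_two x (2 * m)

theorem eq_of_isPrimitiveRoot [IsDomain R] {x y : R} {n : ℕ} (hx : IsPrimitiveRoot x (n + 1))
    (hxy : x * y ^ 2 = 1) {k : ℕ} (hk : k ≤ n) :
    gaussBinom x n k = (-1) ^ k * y ^ (k ^ 2 + k) := by
  induction k with
  | zero => simp
  | succ k ih =>
    have hne : 1 - x ^ (k + 1) ≠ 0 :=
      sub_ne_zero.2 (hx.pow_ne_one_of_pos_of_lt (by omega) (by omega)).symm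
    have hz : gaussBinom x (n + 1) (k + 1) = 0 := by
      have h := one_sub_pow_mul x n k
      rw [hx.pow_eq_one, sub_self, zero_mul] at h
      exact (mul_eq_zero.1 h).resolve_left hne
    rw [succ_succ, ih (by omega)] at hz
    have hp : x ^ (k + 1) * y ^ (2 * (k + 1)) = 1 := by
      rw [pow_mul, ← mul_pow, hxy, one_pow]
    linear_combination y ^ (2 * (k + 1)) * hz - gaussBinom x n (k + 1) * hp

end CommRing

end gaussBinom

theorem Function.Periodic.sum_range_add {M : Type*} [AddCommMonoid M] {f : ℕ → M} {n : ℕ}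
    (hf : Function.Periodic f n) (h : ℕ) :
    ∑ k ∈ Finset.range n, f (k + h) = ∑ k ∈ Finset.range n, f k := by
  induction h with
  | zero => rfl
  | succ h ih =>
    have hn : f (n + h) = f (0 + h) := by rw [zero_add, add_comm]; exact hf h
    rw [← ih]
    cases n with
    | zero => rfl
    | succ n =>
      rw [Finset.sum_range_succ, Finset.sum_range_succ' (fun k ↦ f (k + h)), ← hn]
      simp only [add_right_comm, add_assoc]

/-- Gauss's product formula for the quadratic Gauss sum of odd order. -/
theorem IsPrimitiveRoot.sum_pow_sq_eq_prod {F : Type*} [Field F] {ζ : F} {m : ℕ}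
    (hζ : IsPrimitiveRoot ζ (2 * m + 1)) :
    ∑ k ∈ Finset.range (2 * m + 1), ζ ^ k ^ 2 =
      ∏ t ∈ Finset.range m, (ζ ^ (2 * t + 1) - ζ⁻¹ ^ (2 * t + 1)) := by
  have hζ0 : ζ ≠ 0 := hζ.ne_zero (by omega)
  have hω : IsPrimitiveRoot (ζ⁻¹ ^ 2) (2 * m + 1) :=
    hζ.inv.pow_of_coprime 2 (by simp)
  have hmul : ζ⁻¹ ^ 2 * ζ ^ 2 = 1 := by rw [← mul_pow, inv_mul_cancel₀ hζ0, one_pow]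
  have hsum : ∑ k ∈ Finset.range (2 * m + 1), ζ ^ (k ^ 2 + k) =
      ∏ t ∈ Finset.range m, (1 - (ζ⁻¹ ^ 2) ^ (2 * t + 1)) := by
    rw [← gaussBinom.alternating_sum_two_mul]
    refine Finset.sum_congr rfl fun k hk ↦ ?_
    rw [gaussBinom.eq_of_isPrimitiveRoot hω hmul (Nat.lt_succ_iff.1 (Finset.mem_range.1 hk)),
      ← mul_assoc, ← mul_pow]
    simp
  have hper : Function.Periodic (fun k ↦ ζ ^ k ^ 2) (2 * m + 1) := fun k ↦ by
    have : (k + (2 * m + 1)) ^ 2 = k ^ 2 + (2 * m + 1) * (2 * k + (2 * m + 1)) := by ring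
    simp only [this, pow_add ζ (k ^ 2), pow_mul ζ (2 * m + 1), hζ.pow_eq_one, one_pow, mul_one]
  have hodd : ∏ t ∈ Finset.range m, ζ ^ (2 * t + 1) = ζ ^ m ^ 2 := by
    rw [Finset.prod_pow_eq_pow_sum]
    congr 1
    clear * -
    induction m with
    | zero => rfl
    | succ m ih => rw [Finset.sum_range_succ, ih]; ring
  rw [← hper.sum_range_add (m + 1)]
  calc ∑ k ∈ Finset.range (2 * m + 1), ζ ^ (k + (m + 1)) ^ 2
      = ζ ^ m ^ 2 * ∑ k ∈ Finset.range (2 * m + 1), ζ ^ (k ^ 2 + k) := by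
        rw [Finset.mul_sum]
        refine Finset.sum_congr rfl fun k _ ↦ ?_
        have : (k + (m + 1)) ^ 2 = m ^ 2 + (k ^ 2 + k) + (2 * m + 1) * (k + 1) := by ring
        rw [this, pow_add, pow_mul ζ (2 * m + 1), hζ.pow_eq_one, one_pow, mul_one, pow_add]
    _ = _ := by
        rw [hsum, ← hodd, ← Finset.prod_mul_distrib]
        refine Finset.prod_congr rfl fun t _ ↦ ?_
        rw [mul_sub, mul_one, pow_right_comm, sq, ← mul_assoc, ← mul_pow ζ,
          mul_inv_cancel₀ hζ0, one_pow, one_mul]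

theorem IsPrimitiveRoot.prod_one_sub_pow_odd_mul_inv {F : Type*} [Field F] {ω : F} {m : ℕ}
    (hω : IsPrimitiveRoot ω (2 * m + 1)) :
    ∏ t ∈ Finset.range m, (1 - ω ^ (2 * t + 1)) * (1 - ω⁻¹ ^ (2 * t + 1)) =
      ((2 * m + 1 : ℕ) : F) := by
  have hω0 : ω ≠ 0 := hω.ne_zero (by omega)
  have hsplit (n : ℕ) : ∏ k ∈ Finset.range (2 * n), (1 - ω ^ (k + 1)) =
      (∏ t ∈ Finset.range n, (1 - ω ^ (2 * t + 1))) *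
        ∏ t ∈ Finset.range n, (1 - ω ^ (2 * t + 2)) := by
    induction n with
    | zero => simp
    | succ n ih =>
      rw [mul_add, mul_one, Finset.prod_range_succ, Finset.prod_range_succ, ih,
        Finset.prod_range_succ, Finset.prod_range_succ]
      ring
  have hK := hω.prod_one_sub_pow_eq_order
  rw [hsplit m, ← Finset.prod_range_reflect (fun t ↦ 1 - ω ^ (2 * t + 2)),
    ← Finset.prod_mul_distrib] at hK
  push_cast at hK ⊢
  rw [← hK]
  refine Finset.prod_congr rfl fun t ht ↦ ?_
  have ht := Finset.mem_range.1 ht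
  congr 2
  rw [inv_pow]
  refine inv_eq_of_mul_eq_one_right ?_
  rw [← pow_add, show 2 * t + 1 + (2 * (m - 1 - t) + 2) = 2 * m + 1 by omega, hω.pow_eq_one]

theorem Complex.exp_two_pi_I_div_pow_sub_inv_pow (n j : ℕ) :
    Complex.exp (2 * Real.pi * Complex.I / n) ^ j -
        (Complex.exp (2 * Real.pi * Complex.I / n))⁻¹ ^ j =
      Complex.I * ((2 * Real.sin (2 * Real.pi * j / n) : ℝ) : ℂ) := by
  rw [← Complex.exp_neg, ← Complex.exp_nat_mul, ← Complex.exp_nat_mul]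
  push_cast
  rw [Complex.two_sin, show (j : ℂ) * (2 * Real.pi * Complex.I / n) =
      2 * Real.pi * j / n * Complex.I by ring,
    show (j : ℂ) * -(2 * Real.pi * Complex.I / n) = -(2 * Real.pi * j / n) * Complex.I by ring]
  linear_combination
    (Complex.exp (2 * Real.pi * j / n * Complex.I) -
      Complex.exp (-(2 * Real.pi * j / n) * Complex.I)) * Complex.I_sq

theorem Real.prod_two_mul_sin_odd_sq (m : ℕ) :
    (∏ t ∈ Finset.range m,
      2 * Real.sin (2 * Real.pi * (2 * t + 1 : ℕ) / (2 * m + 1 : ℕ))) ^ 2 =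
        ((2 * m + 1 : ℕ) : ℝ) := by
  have hζ := Complex.isPrimitiveRoot_exp (2 * m + 1) (by omega)
  have hs := Complex.exp_two_pi_I_div_pow_sub_inv_pow (2 * m + 1)
  set ζ := Complex.exp (2 * Real.pi * Complex.I / (2 * m + 1 : ℕ))
  have hζ0 : ζ ≠ 0 := Complex.exp_ne_zero _
  have h := (hζ.pow_of_coprime 2 (by simp)).prod_one_sub_pow_odd_mul_inv
  rw [← Complex.ofReal_inj, ← Finset.prod_pow, Complex.ofReal_prod, Complex.ofReal_natCast, ← h]
  refine Finset.prod_congr rfl fun t _ ↦ ?_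
  have hm : ζ ^ (2 * t + 1) * ζ⁻¹ ^ (2 * t + 1) = 1 := by
    rw [← mul_pow, mul_inv_cancel₀ hζ0, one_pow]
  have ht := hs (2 * t + 1)
  rw [← inv_pow, pow_right_comm, pow_right_comm ζ⁻¹,
    Complex.ofReal_pow]
  generalize ((2 * Real.sin _ : ℝ) : ℂ) = s at *
  generalize ζ ^ (2 * t + 1) = a at *
  generalize ζ⁻¹ ^ (2 * t + 1) = b at *
  linear_combination (a - b + Complex.I * s) * ht + s ^ 2 * Complex.I_sq + (1 - a * b) * hm

theorem Real.prod_two_mul_sin_odd (m : ℕ) :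
    ∏ t ∈ Finset.range m, 2 * Real.sin (2 * Real.pi * (2 * t + 1 : ℕ) / (2 * m + 1 : ℕ)) =
      (-1) ^ (m / 2) * Real.sqrt (2 * m + 1 : ℕ) := by
  have hsq := Real.prod_two_mul_sin_odd_sq m
  have hpos : 0 ≤ (-1) ^ (m / 2) * ∏ t ∈ Finset.range m,
      2 * Real.sin (2 * Real.pi * (2 * t + 1 : ℕ) / (2 * m + 1 : ℕ)) := by
    have hm0 : (0 : ℝ) < (2 * m + 1 : ℕ) := by positivity
    rw [← Finset.prod_range_mul_prod_Ico _ (by omega : m - m / 2 ≤ m), mul_left_comm]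
    refine mul_nonneg (Finset.prod_nonneg fun t ht ↦ ?_) ?_
    · have ht := Finset.mem_range.1 ht
      refine mul_nonneg zero_le_two (Real.sin_nonneg_of_nonneg_of_le_pi (by positivity) ?_)
      rw [div_le_iff₀ hm0, mul_assoc, mul_left_comm]
      refine mul_le_mul_of_nonneg_left ?_ Real.pi_pos.le
      exact_mod_cast (by omega : 2 * (2 * t + 1) ≤ 2 * m + 1)
    · have hcard : (Finset.Ico (m - m / 2) m).card = m / 2 := by
        rw [Nat.card_Ico]; omega
      nth_rw 1 [← hcard]
      rw [← Finset.prod_const, ← Finset.prod_mul_distrib]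
      refine Finset.prod_nonneg fun t ht ↦ ?_
      have ht := Finset.mem_Ico.1 ht
      suffices Real.sin (2 * Real.pi * (2 * t + 1 : ℕ) / (2 * m + 1 : ℕ)) ≤ 0 by linarith
      rw [← neg_nonneg, ← Real.sin_sub_pi]
      refine Real.sin_nonneg_of_nonneg_of_le_pi ?_ ?_
      · rw [sub_nonneg, le_div_iff₀ hm0, mul_assoc, mul_left_comm]
        refine mul_le_mul_of_nonneg_left ?_ Real.pi_pos.le
        exact_mod_cast (by omega : 2 * m + 1 ≤ 2 * (2 * t + 1))
      · rw [sub_le_iff_le_add, div_le_iff₀ hm0, ← two_mul]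
        refine mul_le_mul_of_nonneg_left ?_ Real.two_pi_pos.le
        exact_mod_cast (by omega : 2 * t + 1 ≤ 2 * m + 1)
  have hone : ((-1 : ℝ) ^ (m / 2)) * (-1) ^ (m / 2) = 1 := by rw [← mul_pow]; simp
  have hsqrt := Real.sqrt_sq hpos
  rw [mul_pow, hsq, sq, hone, one_mul] at hsqrt
  rw [hsqrt, ← mul_assoc, hone, one_mul]

theorem Complex.sum_exp_two_pi_I_div_pow_sq (m : ℕ) :
    ∑ k ∈ Finset.range (2 * m + 1),
        Complex.exp (2 * Real.pi * Complex.I / (2 * m + 1 : ℕ)) ^ k ^ 2 =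
      Complex.I ^ m * (-1) ^ (m / 2) * Real.sqrt (2 * m + 1 : ℕ) := by
  rw [(Complex.isPrimitiveRoot_exp (2 * m + 1) (by omega)).sum_pow_sq_eq_prod]
  simp only [Complex.exp_two_pi_I_div_pow_sub_inv_pow]
  rw [Finset.prod_mul_distrib, Finset.prod_const, Finset.card_range, ← Complex.ofReal_prod,
    Real.prod_two_mul_sin_odd]
  push_cast
  ring

/-- The quadratic Gauss sum `G = Σ_{α=0}^{K-1} q^(α²)`, `q = e^(2πi/K)`, `K` an odd
prime, satisfies `G² = (-1)^((K-1)/2)·K`; moreover `G = √K` if `K ≡ 1 [MOD 4]` and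
`G = i√K` if `K ≡ 3 [MOD 4]`. -/
theorem stmt2 (K : ℕ) (hK : K.Prime) (hodd : Odd K)
    (q : ℂ) (hq : q = Complex.exp (2 * Real.pi * Complex.I / K))
    (G : ℂ) (hG : G = ∑ α ∈ Finset.range K, q ^ (α ^ 2)) :
    G ^ 2 = (-1 : ℂ) ^ ((K - 1) / 2) * K ∧
    (K % 4 = 1 → G = Real.sqrt K) ∧
    (K % 4 = 3 → G = Complex.I * Real.sqrt K) := by
  obtain ⟨m, rfl⟩ := hodd
  have hone (l : ℕ) : ((-1 : ℂ) ^ l) * (-1) ^ l = 1 := by rw [← mul_pow]; simp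
  rw [hq, Complex.sum_exp_two_pi_I_div_pow_sq] at hG
  subst hG
  refine ⟨?_, fun h ↦ ?_, fun h ↦ ?_⟩
  · have hs : ((Real.sqrt (2 * m + 1 : ℕ) : ℝ) : ℂ) ^ 2 = (2 * m + 1 : ℕ) := by
      rw [← Complex.ofReal_pow, Real.sq_sqrt (Nat.cast_nonneg _), Complex.ofReal_natCast]
    rw [mul_pow, hs, mul_pow, pow_right_comm, Complex.I_sq, sq, hone, mul_one,
      show (2 * m + 1 - 1) / 2 = m by omega]
  · obtain ⟨l, rfl⟩ : ∃ l, m = 2 * l := ⟨m / 2, by omega⟩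
    rw [pow_mul, Complex.I_sq, Nat.mul_div_cancel_left l two_pos, hone, one_mul]
  · obtain ⟨l, rfl⟩ : ∃ l, m = 2 * l + 1 := ⟨m / 2, by omega⟩
    rw [pow_succ, pow_mul, Complex.I_sq, show (2 * l + 1) / 2 = l by omega,
      mul_right_comm _ Complex.I, hone, one_mul]
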